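/- (Appendix B Lemma / Lemma on temporary buffer states) Let N and M be positive integers. Let F^π, F^λ ∈ {0,1}^N be buffer state vectors satisfying prefix domination: Σ_{n=1}^j F^π_n ≤ Σ_{n=1}^j F^λ_n for all j ∈ {1,…,N}. Let s^π ∈ {0,1}^N be any work-conserving service vector for F^π, i.e., s^π_n ≤ F^π_n for all n and Σ_{n=1}^N s^π_n = min(M, Σ_{n=1}^N F^π_n). Let s^λ ∈ {0,1}^N be the Max-λ service vector for F^λ, i.e., s^λ_n = 1 if and only if F^λ_n = 1 and the number of indices m > n with F^λ_m = 1 is strictly less than M. Then the post-service vectors satisfy Σ_{n=1}^j (F^π_n − s^π_n) ≤ Σ_{n=1}^j (F^λ_n − s^λ_n) for all j ∈ {1,…,N}. -/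

import Mathlib

open Finset

/-- The ones of a binary sequence beyond `n`, together with its sum up to `n`, give the total. -/
lemma card_ones_above_add_prefix_sum {N n : ℕ} {F : ℕ → ℕ}
    (hF : ∀ m ∈ Finset.Icc 1 N, F m ≤ 1) (hn : n ≤ N) :
    ((Finset.Icc 1 N).filter (fun m => n < m ∧ F m = 1)).card + ∑ m ∈ Finset.Icc 1 n, F m =
      ∑ m ∈ Finset.Icc 1 N, F m := by
  have hprefix : Finset.Icc 1 n = (Finset.Icc 1 N).filter (fun m => m ≤ n) := by
    ext m
    simp only [Finset.mem_Icc, Finset.mem_filter]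
    omega
  rw [hprefix, Finset.sum_filter, Finset.card_filter, ← Finset.sum_add_distrib]
  refine Finset.sum_congr rfl fun m hm => ?_
  have := hF m hm
  split_ifs <;> omega

/-- After serving the `M` largest nonempty indices, each prefix retains at least the minimum of its
original content and the total content left. -/
lemma min_prefix_sum_le_sum_sub_maxService {N M : ℕ} {F s : ℕ → ℕ}
    (hF : ∀ n ∈ Finset.Icc 1 N, F n ≤ 1) (hs : ∀ n ∈ Finset.Icc 1 N, s n ≤ 1)
    (hmax : ∀ n ∈ Finset.Icc 1 N, (s n = 1 ↔ (F n = 1 ∧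
      ((Finset.Icc 1 N).filter (fun m => n < m ∧ F m = 1)).card < M))) {j : ℕ} (hj : j ≤ N) :
    min (∑ n ∈ Finset.Icc 1 j, F n) (∑ n ∈ Finset.Icc 1 N, F n - M) ≤
      ∑ n ∈ Finset.Icc 1 j, (F n - s n) := by
  induction j with
  | zero => simp
  | succ j ih =>
    have hmem : j + 1 ∈ Finset.Icc 1 N := Finset.mem_Icc.2 ⟨by omega, hj⟩
    have hprev := ih (by omega)
    have hcard := card_ones_above_add_prefix_sum hF hj
    have hFj := hF _ hmem
    have hsj := hs _ hmem
    have hmaxj := hmax _ hmem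
    rw [Finset.sum_Icc_succ_top (by omega)] at hcard
    rw [Finset.sum_Icc_succ_top (by omega), Finset.sum_Icc_succ_top (by omega)]
    by_cases h : s (j + 1) = 1
    · have := hmaxj.1 h
      omega
    · omega

/-- Appendix B Lemma: If the buffer states under policy `π` (here `Fpi`)
are prefix-dominated by those under Max-λ (here `Fml`), then after any work-conserving
service `spi` for `Fpi` and the Max-λ service `sml` for `Fml`, prefix domination of the
post-service (temporary) buffer states still holds. Queues are indexed `1,…,N` with
arrival rates sorted in increasing order; Max-λ serves the nonempty queues with the
largest indices. -/
theorem stmt10 (N M : ℕ) (hN : 0 < N) (hM : 0 < M)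
    (Fpi Fml spi sml : ℕ → ℕ)
    (hFpibin : ∀ n ∈ Finset.Icc 1 N, Fpi n ≤ 1)
    (hFmlbin : ∀ n ∈ Finset.Icc 1 N, Fml n ≤ 1)
    (hdom : ∀ j ∈ Finset.Icc 1 N,
      ∑ n ∈ Finset.Icc 1 j, Fpi n ≤ ∑ n ∈ Finset.Icc 1 j, Fml n)
    (hspile : ∀ n ∈ Finset.Icc 1 N, spi n ≤ Fpi n)
    (hwc : ∑ n ∈ Finset.Icc 1 N, spi n = min M (∑ n ∈ Finset.Icc 1 N, Fpi n))
    (hsmlbin : ∀ n ∈ Finset.Icc 1 N, sml n ≤ 1)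
    (hsml : ∀ n ∈ Finset.Icc 1 N, (sml n = 1 ↔ (Fml n = 1 ∧
      ((Finset.Icc 1 N).filter (fun m => n < m ∧ Fml m = 1)).card < M))) :
    ∀ j ∈ Finset.Icc 1 N,
      ∑ n ∈ Finset.Icc 1 j, (Fpi n - spi n) ≤ ∑ n ∈ Finset.Icc 1 j, (Fml n - sml n) := by
  intro j hj
  obtain ⟨hj1, hjN⟩ := Finset.mem_Icc.1 hj
  refine le_trans (le_min ?_ ?_)
    (min_prefix_sum_le_sum_sub_maxService hFmlbin hsmlbin hsml hjN)
  · exact (Finset.sum_le_sum fun n _ => Nat.sub_le _ _).trans (hdom j hj)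
  · have hmono : ∑ n ∈ Finset.Icc 1 j, (Fpi n - spi n) ≤ ∑ n ∈ Finset.Icc 1 N, (Fpi n - spi n) :=
      Finset.sum_le_sum_of_subset (Finset.Icc_subset_Icc_right hjN)
    have htotal := hdom N (Finset.mem_Icc.2 ⟨hN, le_rfl⟩)
    rw [Finset.sum_tsub_distrib _ hspile] at hmono
    omega
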